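/- arXiv:2209.03905 — 6 statements merged into one kernel-verified Lean document; each statement's English description precedes it below -/
import Mathlib

section
/- Assume u < v. For every natural number c with count_{u,v}(D) ≤ c + K, c ≤ count_{u,v}(D) + K, and c ≤ D.length, there exists a K-neighbor D' of D with count_{u,v}(D') = c. (In K-local-sensitivity-bounded neighboring databases, the count of the range [u,v) attains exactly the values from max(count−K,0) to min(count+K, size(D)).) -/
/-- Number of entries `x` of the database column `D` with `u ≤ x` and `x < v`. -/
noncomputable def rangeCount (u v : ℝ) (D : List ℝ) : ℕ :=
  D.countP (fun x => decide (u ≤ x ∧ x < v))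

/-- Number of positions at which two lists (of the same length) differ. -/
noncomputable def diffCount (D D' : List ℝ) : ℕ :=
  (D.zip D').countP (fun p => decide (p.1 ≠ p.2))

/-- `D'` is a `K`-neighbor of `D`: same length, and at most `K` modified records. -/
def IsKNeighbor (K : ℕ) (D D' : List ℝ) : Prop :=
  D'.length = D.length ∧ diffCount D D' ≤ K

/-- The threshold query `f_{b,u,v}`: `1` if `count_{u,v}(D) > b`, else `0`. -/
noncomputable def fQuery (u v : ℝ) (b : ℕ) (D : List ℝ) : ℕ :=
  if b < rangeCount u v D then 1 else 0

/-- `S(D)`: the set of thresholds `b` at which the `K`-local sensitivity of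
`f_{b,u,v}` is one. -/
def SLS (u v : ℝ) (K : ℕ) (D : List ℝ) : Set ℕ :=
  {b : ℕ | rangeCount u v D ≤ b + K ∧ b < rangeCount u v D + K ∧ b < D.length}

/-- Any count `c ≤ D.length` is attained by modifying at most `|c - rangeCount u v D|` records. -/
theorem exists_rangeCount_eq_and_diffCount_le {u v : ℝ} (huv : u < v) (D : List ℝ) (c : ℕ)
    (hc : c ≤ D.length) :
    ∃ D' : List ℝ, D'.length = D.length ∧ rangeCount u v D' = c ∧
      diffCount D D' ≤ (c - rangeCount u v D) + (rangeCount u v D - c) := by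
  induction D generalizing c with
  | nil => exact ⟨[], by simp_all [rangeCount, diffCount]⟩
  | cons x D ih =>
    simp only [rangeCount, diffCount, List.length_cons] at ih hc ⊢
    by_cases hx : u ≤ x ∧ x < v
    · cases c with
      | zero =>
        obtain ⟨D', hl, hr, hd⟩ := ih 0 (Nat.zero_le _)
        refine ⟨v :: D', by simp [hl], by simpa using hr, ?_⟩
        simp [hx, hx.2.ne] at hd ⊢
        omega
      | succ c =>
        obtain ⟨D', hl, hr, hd⟩ := ih c (by omega)
        refine ⟨x :: D', by simp [hl], by simpa [List.countP_cons, hx] using hr, ?_⟩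
        simp [hx] at hd ⊢
        omega
    · by_cases hcl : c ≤ D.length
      · obtain ⟨D', hl, hr, hd⟩ := ih c hcl
        refine ⟨x :: D', by simp [hl], ?_, ?_⟩
        · rw [List.countP_cons_of_neg (by simpa using hx), hr]
        · rw [List.countP_cons_of_neg (l := D) (by simpa using hx)]
          simpa using hd
      · obtain ⟨D', hl, hr, hd⟩ := ih D.length le_rfl
        have hxu : x ≠ u := by
          rintro rfl
          exact hx ⟨le_rfl, huv⟩
        have hle := List.countP_le_length (p := fun x => decide (u ≤ x ∧ x < v)) (l := D)
        refine ⟨u :: D', by simp [hl], ?_, ?_⟩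
        · rw [List.countP_cons_of_pos (by simpa using huv), hr]
          omega
        · rw [List.countP_cons_of_neg (l := D) (by simpa using hx), List.zip_cons_cons,
            List.countP_cons_of_pos (by simpa using hxu)]
          omega

theorem exists_neighbor_with_count (u v : ℝ) (huv : u < v) (K : ℕ) (D : List ℝ)
    (c : ℕ) (h₁ : rangeCount u v D ≤ c + K) (h₂ : c ≤ rangeCount u v D + K)
    (h₃ : c ≤ D.length) :
    ∃ D' : List ℝ, IsKNeighbor K D D' ∧ rangeCount u v D' = c := by
  obtain ⟨D', hl, hr, hd⟩ := exists_rangeCount_eq_and_diffCount_le huv D c h₃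
  exact ⟨D', ⟨hl, by omega⟩, hr⟩
end

section
/- Assume u < v. If b < count_{u,v}(D) and count_{u,v}(D) ≤ b + K, then there exists a K-neighbor D' of D with count_{u,v}(D') ≤ b (so f_{b,u,v}(D) = 1 while f_{b,u,v}(D') = 0, witnessing K-local sensitivity 1). -/
theorem diffCount_self (D : List ℝ) : diffCount D D = 0 := by
  induction D with
  | nil => simp [diffCount]
  | cons x D ih => simpa [diffCount, List.countP_cons] using ih

theorem diffCount_cons (x y : ℝ) (D D' : List ℝ) :
    diffCount (x :: D) (y :: D') = diffCount D D' + if x ≠ y then 1 else 0 := by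
  simp [diffCount, List.countP_cons]

theorem rangeCount_cons (u v x : ℝ) (D : List ℝ) :
    rangeCount u v (x :: D) = rangeCount u v D + if u ≤ x ∧ x < v then 1 else 0 := by
  simp [rangeCount, List.countP_cons]

/-- Moving up to `K` in-range records to the excluded endpoint `v` lowers the count by `K`. -/
theorem exists_isKNeighbor_rangeCount_le (u v : ℝ) (b : ℕ) (D : List ℝ) (K : ℕ)
    (h : rangeCount u v D ≤ b + K) :
    ∃ D' : List ℝ, IsKNeighbor K D D' ∧ rangeCount u v D' ≤ b := by
  induction D generalizing K b with
  | nil => exact ⟨[], ⟨rfl, by simp [diffCount]⟩, by simp [rangeCount]⟩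
  | cons x D ih =>
    rw [rangeCount_cons] at h
    by_cases hx : u ≤ x ∧ x < v
    · rw [if_pos hx] at h
      cases K with
      | zero =>
        refine ⟨x :: D, ⟨rfl, (diffCount_self _).le⟩, ?_⟩
        rw [rangeCount_cons, if_pos hx]
        exact h
      | succ K =>
        obtain ⟨D', ⟨hl, hd⟩, hc⟩ := ih b K (by omega)
        refine ⟨v :: D', ⟨by simp [hl], ?_⟩, ?_⟩
        · rw [diffCount_cons, if_pos hx.2.ne]
          omega
        · simpa [rangeCount_cons] using hc
    · rw [if_neg hx] at h
      obtain ⟨D', ⟨hl, hd⟩, hc⟩ := ih b K h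
      refine ⟨x :: D', ⟨by simp [hl], ?_⟩, ?_⟩
      · simpa [diffCount_cons] using hd
      · simpa [rangeCount_cons, hx] using hc

theorem exists_neighbor_count_le (u v : ℝ) (huv : u < v) (K b : ℕ) (D : List ℝ)
    (h₁ : b < rangeCount u v D) (h₂ : rangeCount u v D ≤ b + K) :
    ∃ D' : List ℝ, IsKNeighbor K D D' ∧ rangeCount u v D' ≤ b ∧
      fQuery u v b D = 1 ∧ fQuery u v b D' = 0 := by
  obtain ⟨D', hn, hc⟩ := exists_isKNeighbor_rangeCount_le u v b D K h₂
  exact ⟨D', hn, hc, if_pos h₁, if_neg hc.not_gt⟩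
end

section
/- Assume u < v. If count_{u,v}(D) ≤ b, b < count_{u,v}(D) + K, and b < D.length, then there exists a K-neighbor D' of D with b < count_{u,v}(D') (so f_{b,u,v}(D) = 0 while f_{b,u,v}(D') = 1, witnessing K-local sensitivity 1). -/
/-- A column with at least `m` entries outside `[u, v)` has an `m`-neighbor with exactly `m` more
entries in `[u, v)`. -/
theorem exists_isKNeighbor_rangeCount_eq {u v : ℝ} (huv : u < v) (D : List ℝ) (m : ℕ)
    (hm : rangeCount u v D + m ≤ D.length) :
    ∃ D' : List ℝ, IsKNeighbor m D D' ∧ rangeCount u v D' = rangeCount u v D + m := by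
  induction D generalizing m with
  | nil =>
    obtain rfl : m = 0 := by simp at hm; omega
    exact ⟨[], ⟨rfl, by simp [diffCount]⟩, rfl⟩
  | cons x D ih =>
    simp only [IsKNeighbor, rangeCount, diffCount, List.countP_cons, List.length_cons,
      decide_eq_true_eq] at ih hm ⊢
    by_cases hx : u ≤ x ∧ x < v
    · rw [if_pos hx] at hm ⊢
      obtain ⟨D', ⟨hlen, hdiff⟩, hcount⟩ := ih m (by omega)
      refine ⟨x :: D', ⟨by simp [hlen], by simpa using hdiff⟩, ?_⟩
      rw [List.countP_cons, if_pos (by simpa using hx)]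
      omega
    · rw [if_neg hx] at hm ⊢
      cases m with
      | zero =>
        obtain ⟨D', ⟨hlen, hdiff⟩, hcount⟩ := ih 0 List.countP_le_length
        refine ⟨x :: D', ⟨by simp [hlen], by simpa using hdiff⟩, ?_⟩
        rw [List.countP_cons, if_neg (by simpa using hx)]
        omega
      | succ m =>
        obtain ⟨D', ⟨hlen, hdiff⟩, hcount⟩ := ih m (by omega)
        refine ⟨u :: D', ⟨by simp [hlen], ?_⟩, ?_⟩
        · rw [List.zip_cons_cons, List.countP_cons]
          split_ifs <;> omega
        · rw [List.countP_cons, if_pos (by simpa using huv)]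
          omega

theorem exists_neighbor_lt_count (u v : ℝ) (huv : u < v) (K b : ℕ) (D : List ℝ)
    (h₁ : rangeCount u v D ≤ b) (h₂ : b < rangeCount u v D + K)
    (h₃ : b < D.length) :
    ∃ D' : List ℝ, IsKNeighbor K D D' ∧ b < rangeCount u v D' ∧
      fQuery u v b D = 0 ∧ fQuery u v b D' = 1 := by
  obtain ⟨D', ⟨hlen, hdiff⟩, hcount⟩ :=
    exists_isKNeighbor_rangeCount_eq huv D (b + 1 - rangeCount u v D) (by omega)
  have hlt : b < rangeCount u v D' := by omega
  exact ⟨D', ⟨hlen, by omega⟩, hlt, if_neg (by omega), if_pos hlt⟩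
end

section
/- Correctness of the GetRangeCount attack (Algorithm 4): assume u < v, 1 ≤ K, and 2K ≤ D.length. Let L = sInf S(D) and R = sInf {b : ℕ | count_{u,v}(D) ≤ b ∧ b ∉ S(D)}. Then the value returned by the algorithm, namely (if 0 < L then L + K else if R < D.length then R − K else L + K), equals count_{u,v}(D). -/
theorem rangeCount_le_length (u v : ℝ) (D : List ℝ) : rangeCount u v D ≤ D.length :=
  List.countP_le_length

/-- The least threshold in `S(D)` is `count - K` (truncated at zero). -/
theorem isLeast_SLS (u v : ℝ) {K : ℕ} (hK : 1 ≤ K) {D : List ℝ} (hD : 2 * K ≤ D.length) :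
    IsLeast (SLS u v K D) (rangeCount u v D - K) := by
  have hc := rangeCount_le_length u v D
  refine ⟨⟨?_, ?_, ?_⟩, fun b hb => ?_⟩
  · omega
  · omega
  · omega
  · have := hb.1
    omega

/-- The least threshold above the count lying outside `S(D)` is `min (count + K) D.length`. -/
theorem isLeast_compl_SLS (u v : ℝ) (K : ℕ) (D : List ℝ) :
    IsLeast {b : ℕ | rangeCount u v D ≤ b ∧ b ∉ SLS u v K D}
      (min (rangeCount u v D + K) D.length) := by
  have hc := rangeCount_le_length u v D
  refine ⟨⟨by omega, fun h => ?_⟩, fun b hb => ?_⟩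
  · obtain ⟨-, h₁, h₂⟩ := h
    omega
  · obtain ⟨hb₁, hb₂⟩ := hb
    by_contra hlt
    exact hb₂ ⟨by omega, by omega, by omega⟩

theorem getRangeCount_correct (u v : ℝ) (huv : u < v) (K : ℕ) (hK : 1 ≤ K)
    (D : List ℝ) (hD : 2 * K ≤ D.length)
    (L R : ℕ) (hL : L = sInf (SLS u v K D))
    (hR : R = sInf {b : ℕ | rangeCount u v D ≤ b ∧ b ∉ SLS u v K D}) :
    (if 0 < L then L + K else if R < D.length then R - K else L + K) =
      rangeCount u v D := by
  have hc := rangeCount_le_length u v D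
  rw [(isLeast_SLS u v hK hD).csInf_eq] at hL
  rw [(isLeast_compl_SLS u v K D).csInf_eq] at hR
  split_ifs <;> omega
end

section
/- Observation lemma, case 2: let z : ℝ with z ∉ {−1, 0, 1}, and define the observed output o(b) = f_{b,u,v}(D) + z (as a real number) if b ∈ S(D), and o(b) = f_{b,u,v}(D) otherwise. If o(b) = 0, then count_{u,v}(D) ≤ b and min(count_{u,v}(D) + K, D.length) ≤ b. -/
open Classical in
theorem observed_zero (u v : ℝ) (K b : ℕ) (D : List ℝ) (z : ℝ)
    (hz : z ∉ ({-1, 0, 1} : Set ℝ))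
    (o : ℝ)
    (ho : o = if b ∈ SLS u v K D then (fQuery u v b D : ℝ) + z
              else (fQuery u v b D : ℝ))
    (h0 : o = 0) :
    rangeCount u v D ≤ b ∧ min (rangeCount u v D + K) D.length ≤ b := by
  subst ho
  by_cases hS : b ∈ SLS u v K D
  · rw [if_pos hS] at h0
    refine absurd ?_ hz
    simp only [Set.mem_insert_iff, Set.mem_singleton_iff]
    unfold fQuery at h0
    split_ifs at h0
    · left
      push_cast at h0
      linarith
    · right; left
      simpa using h0
  · rw [if_neg hS] at h0
    have hb : rangeCount u v D ≤ b := by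
      by_contra! h
      simp [fQuery, h] at h0
    refine ⟨hb, ?_⟩
    by_contra! h
    rw [lt_min_iff] at h
    exact hS ⟨by omega, h.1, h.2⟩
end

section
/- Failure of reconstruction for small databases: assume u < v, 0 < n, and n < 2K. Then there exist lists D, D' : List ℝ, both of length n, with count_{u,v}(D) ≠ count_{u,v}(D'), such that count_{u,v}(D) ≤ K, count_{u,v}(D') ≤ K, n ≤ count_{u,v}(D) + K, and n ≤ count_{u,v}(D') + K. (For both databases the K-local sensitivity of f_{b,u,v} is 1 for every b < n and f_{b,u,v} = 0 for every b ≥ n, so there is no transition between binary and non-binary observed values inside the boundary of the database and the true count cannot be reconstructed.) -/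
theorem exists_length_eq_rangeCount_eq {u v : ℝ} (huv : u < v) {c n : ℕ} (hc : c ≤ n) :
    ∃ D : List ℝ, D.length = n ∧ rangeCount u v D = c :=
  ⟨List.replicate c u ++ List.replicate (n - c) v, by simp [hc],
    by simp [rangeCount, List.countP_replicate, huv]⟩

theorem reconstruction_fails_for_small_databases (u v : ℝ) (huv : u < v)
    (K n : ℕ) (hn : 0 < n) (hnK : n < 2 * K) :
    ∃ D D' : List ℝ, D.length = n ∧ D'.length = n ∧
      rangeCount u v D ≠ rangeCount u v D' ∧
      rangeCount u v D ≤ K ∧ rangeCount u v D' ≤ K ∧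
      n ≤ rangeCount u v D + K ∧ n ≤ rangeCount u v D' + K := by
  obtain ⟨D, hD, hcD⟩ :=
    exists_length_eq_rangeCount_eq huv (show n - K ≤ n by omega)
  obtain ⟨D', hD', hcD'⟩ :=
    exists_length_eq_rangeCount_eq huv (show n - K + 1 ≤ n by omega)
  exact ⟨D, D', hD, hD', by omega, by omega, by omega, by omega, by omega⟩
end
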